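/- arXiv:2305.07770 — 3 statements merged into one kernel-verified Lean document; each statement's English description precedes it below -/
import Mathlib

section
/- Let t be a positive integer with t >= 10^6, t congruent to 2 modulo 4, whose square-free part contains at least one odd prime factor congruent to 2 modulo 3, and suppose P(t) = 1, i.e., t has exactly one representation t = a^2 + b^2 + c^2 with integers 0 <= a <= b <= c. Then C_3(t) > 5; that is, there do not exist five vectors in Z^3, each with squared Euclidean norm t, summing to the zero vector. -/
/-- A representation of `t` as an ordered sum of three squares `a² + b² + c²`
with `0 ≤ a ≤ b ≤ c`. -/
def IsThreeSquareRep (t : ℕ) (x : ℤ × ℤ × ℤ) : Prop :=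
  0 ≤ x.1 ∧ x.1 ≤ x.2.1 ∧ x.2.1 ≤ x.2.2 ∧ x.1 ^ 2 + x.2.1 ^ 2 + x.2.2 ^ 2 = (t : ℤ)

/-- If every integer point on the sphere of squared radius `p²(a² + b² + c²)` had all its
coordinates divisible by the odd prime `p`, then so would `(a, b, c)`. The points used come from
the rotation attached to a quaternion of norm `p` with nonzero `i` and `j` coefficients. -/
lemma dvd_of_rotation_dvd {p : ℕ} (hp : p.Prime) (hp2 : p ≠ 2) {q x y z a b c : ℤ}
    (hq : q ^ 2 + x ^ 2 + y ^ 2 + z ^ 2 = p) (hx : x ≠ 0) (hy : y ≠ 0)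
    (h : ∀ u₀ u₁ u₂ : ℤ, u₀ ^ 2 + u₁ ^ 2 + u₂ ^ 2 = (p : ℤ) ^ 2 * (a ^ 2 + b ^ 2 + c ^ 2) →
      (p : ℤ) ∣ u₀ ∧ (p : ℤ) ∣ u₁ ∧ (p : ℤ) ∣ u₂) :
    (p : ℤ) ∣ a ∧ (p : ℤ) ∣ b ∧ (p : ℤ) ∣ c := by
  have hpp : Prime (p : ℤ) := Nat.prime_iff_prime_int.mp hp
  have key : ∀ {X Y Z : ℤ}, q ^ 2 + X ^ 2 + Y ^ 2 + Z ^ 2 = p →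
      ((p : ℤ) ∣ (q ^ 2 + X ^ 2 - Y ^ 2 - Z ^ 2) * a + 2 * (X * Y - q * Z) * b
        + 2 * (X * Z + q * Y) * c) ∧
      ((p : ℤ) ∣ 2 * (X * Y + q * Z) * a + (q ^ 2 - X ^ 2 + Y ^ 2 - Z ^ 2) * b
        + 2 * (Y * Z - q * X) * c) := by
    intro X Y Z hn
    have := h ((q ^ 2 + X ^ 2 - Y ^ 2 - Z ^ 2) * a + 2 * (X * Y - q * Z) * b
        + 2 * (X * Z + q * Y) * c)
      (2 * (X * Y + q * Z) * a + (q ^ 2 - X ^ 2 + Y ^ 2 - Z ^ 2) * b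
        + 2 * (Y * Z - q * X) * c)
      (2 * (X * Z - q * Y) * a + 2 * (Y * Z + q * X) * b
        + (q ^ 2 - X ^ 2 - Y ^ 2 + Z ^ 2) * c) (by rw [← hn]; ring)
    exact ⟨this.1, this.2.1⟩
  have small : ∀ r : ℤ, r ≠ 0 → r ^ 2 ≤ p → ¬ (p : ℤ) ∣ r := by
    intro r hr hle hd
    have h1 := Int.le_of_dvd (abs_pos.mpr hr) ((dvd_abs _ _).mpr hd)
    have h2 : (2 : ℤ) ≤ p := by exact_mod_cast hp.two_le
    rw [← sq_abs] at hle
    nlinarith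
  have hpx := small x hx (by nlinarith [sq_nonneg q, sq_nonneg y, sq_nonneg z])
  have hpy := small y hy (by nlinarith [sq_nonneg q, sq_nonneg x, sq_nonneg z])
  have hp8 : ¬ (p : ℤ) ∣ 8 := by
    intro hd
    have h2 : (p : ℤ) ∣ 2 := hpp.dvd_of_dvd_pow (n := 3) (by norm_num; exact hd)
    exact hp2 ((Nat.prime_dvd_prime_iff_eq hp Nat.prime_two).mp (by exact_mod_cast h2))
  have cancel : ∀ r : ℤ, (p : ℤ) ∣ 8 * (x * y * r) → (p : ℤ) ∣ r := by
    intro r hr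
    rcases hpp.dvd_or_dvd hr with h | h
    · exact absurd h hp8
    rcases hpp.dvd_or_dvd h with h | h
    · rcases hpp.dvd_or_dvd h with h | h
      · exact absurd h hpx
      · exact absurd h hpy
    · exact h
  obtain ⟨⟨r₁, h₁⟩, ⟨s₁, k₁⟩⟩ := key (X := x) (Y := y) (Z := z) hq
  obtain ⟨⟨r₂, h₂⟩, ⟨s₂, k₂⟩⟩ := key (X := -x) (Y := y) (Z := z) (by rw [← hq]; ring)
  obtain ⟨⟨r₃, h₃⟩, -⟩ := key (X := x) (Y := y) (Z := -z) (by rw [← hq]; ring)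
  obtain ⟨⟨r₄, h₄⟩, -⟩ := key (X := -x) (Y := y) (Z := -z) (by rw [← hq]; ring)
  obtain ⟨-, ⟨s₃, k₃⟩⟩ := key (X := x) (Y := -y) (Z := z) (by rw [← hq]; ring)
  obtain ⟨-, ⟨s₄, k₄⟩⟩ := key (X := -x) (Y := -y) (Z := z) (by rw [← hq]; ring)
  obtain ⟨⟨m₁, l₁⟩, -⟩ := key (X := x) (Y := z) (Z := y) (by rw [← hq]; ring)
  obtain ⟨⟨m₂, l₂⟩, -⟩ := key (X := -x) (Y := z) (Z := y) (by rw [← hq]; ring)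
  obtain ⟨⟨m₃, l₃⟩, -⟩ := key (X := x) (Y := -z) (Z := y) (by rw [← hq]; ring)
  obtain ⟨⟨m₄, l₄⟩, -⟩ := key (X := -x) (Y := -z) (Z := y) (by rw [← hq]; ring)
  exact ⟨cancel a ⟨s₁ - s₂ - s₃ + s₄, by linear_combination k₁ - k₂ - k₃ + k₄⟩,
    cancel b ⟨r₁ - r₂ + r₃ - r₄, by linear_combination h₁ - h₂ + h₃ - h₄⟩,
    cancel c ⟨m₁ - m₂ + m₃ - m₄, by linear_combination l₁ - l₂ + l₃ - l₄⟩⟩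

/-- A prime is the sum of four squares, the middle two of which can be taken nonzero. -/
lemma Nat.Prime.sum_four_squares_ne_zero {p : ℕ} (hp : p.Prime) :
    ∃ q x y z : ℤ, q ^ 2 + x ^ 2 + y ^ 2 + z ^ 2 = p ∧ x ≠ 0 ∧ y ≠ 0 := by
  obtain ⟨a, b, c, d, h⟩ := Nat.sum_four_squares p
  have nsq : ∀ n : ℕ, n ^ 2 ≠ p := fun n hn =>
    hp.prime.irreducible.not_isSquare ⟨n, by rw [← hn, sq]⟩
  have h' : (a : ℤ) ^ 2 + b ^ 2 + c ^ 2 + d ^ 2 = p := by exact_mod_cast h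
  by_cases ha : a = 0
  · by_cases hb : b = 0
    · by_cases hc : c = 0
      · exact absurd (by simpa [ha, hb, hc] using h) (nsq d)
      · by_cases hd : d = 0
        · exact absurd (by simpa [ha, hb, hd] using h) (nsq c)
        · exact ⟨a, c, d, b, by linarith, by exact_mod_cast hc, by exact_mod_cast hd⟩
    · by_cases hc : c = 0
      · by_cases hd : d = 0
        · exact absurd (by simpa [ha, hc, hd] using h) (nsq b)
        · exact ⟨a, b, d, c, by linarith, by exact_mod_cast hb, by exact_mod_cast hd⟩
      · exact ⟨a, b, c, d, by linarith, by exact_mod_cast hb, by exact_mod_cast hc⟩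
  · by_cases hb : b = 0
    · by_cases hc : c = 0
      · by_cases hd : d = 0
        · exact absurd (by simpa [hb, hc, hd] using h) (nsq a)
        · exact ⟨b, a, d, c, by linarith, by exact_mod_cast ha, by exact_mod_cast hd⟩
      · exact ⟨b, a, c, d, by linarith, by exact_mod_cast ha, by exact_mod_cast hc⟩
    · exact ⟨c, a, b, d, by linarith, by exact_mod_cast ha, by exact_mod_cast hb⟩

/-- A unique representation yields a vector `w`, with even first coordinate, such that every
integer point on the sphere is a signed permutation of `w`. -/
lemma exists_perm_abs_eq {t : ℕ} (hmod : t % 4 = 2)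
    (hP : ∃! x : ℤ × ℤ × ℤ, IsThreeSquareRep t x) :
    ∃ w : Fin 3 → ℤ, ∑ j, w j ^ 2 = t ∧ Even (w 0) ∧ Odd (w 1) ∧ Odd (w 2) ∧
      ∀ u : Fin 3 → ℤ, ∑ j, u j ^ 2 = t → ∃ σ : Equiv.Perm (Fin 3), ∀ j, |u j| = |w (σ j)| := by
  obtain ⟨⟨a, b, c⟩, ⟨-, -, -, hs⟩, huniq⟩ := hP
  simp only at hs
  have hperm : ∀ u : Fin 3 → ℤ, ∑ j, u j ^ 2 = t →
      ∃ σ : Equiv.Perm (Fin 3), ∀ j, |u j| = |![a, b, c] (σ j)| := by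
    intro u hu
    set τ := Tuple.sort (fun j => |u j|)
    have hm : Monotone ((fun j => |u j|) ∘ τ) := Tuple.monotone_sort _
    have hsum : ∑ j, |u (τ j)| ^ 2 = (t : ℤ) := by
      rw [Equiv.sum_comp τ (fun j => |u j| ^ 2)]
      simpa using hu
    rw [Fin.sum_univ_three] at hsum
    have hx := huniq (|u (τ 0)|, |u (τ 1)|, |u (τ 2)|)
      ⟨abs_nonneg _, hm (by decide : (0 : Fin 3) ≤ 1), hm (by decide : (1 : Fin 3) ≤ 2), hsum⟩
    simp only [Prod.mk.injEq] at hx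
    have hall : ∀ j, |u (τ j)| = |![a, b, c] j| := by
      intro j
      fin_cases j <;> simp [← hx.1, ← hx.2.1, ← hx.2.2]
    exact ⟨τ.symm, fun j => by simpa using hall (τ.symm j)⟩
  have reorder : ∀ ρ : Equiv.Perm (Fin 3), Even (![a, b, c] (ρ 0)) → Odd (![a, b, c] (ρ 1)) →
      Odd (![a, b, c] (ρ 2)) → ∃ w : Fin 3 → ℤ, ∑ j, w j ^ 2 = t ∧ Even (w 0) ∧ Odd (w 1) ∧
      Odd (w 2) ∧ ∀ u : Fin 3 → ℤ, ∑ j, u j ^ 2 = t →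
        ∃ σ : Equiv.Perm (Fin 3), ∀ j, |u j| = |w (σ j)| := by
    intro ρ h0 h1 h2
    refine ⟨fun j => ![a, b, c] (ρ j), ?_, h0, h1, h2, fun u hu => ?_⟩
    · rw [Equiv.sum_comp ρ (fun j => ![a, b, c] j ^ 2)]
      simpa [Fin.sum_univ_three] using hs
    · obtain ⟨σ, hσ⟩ := hperm u hu
      exact ⟨σ.trans ρ.symm, fun j => by simpa using hσ j⟩
  have hs4 : (a ^ 2 + b ^ 2 + c ^ 2) % 4 = 2 := by omega
  rcases Int.even_or_odd a with ha | ha <;> rcases Int.even_or_odd b with hb | hb <;>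
    rcases Int.even_or_odd c with hc | hc
  · exfalso; obtain ⟨x, rfl⟩ := ha; obtain ⟨y, rfl⟩ := hb; obtain ⟨z, rfl⟩ := hc
    ring_nf at hs4; omega
  · exfalso; obtain ⟨x, rfl⟩ := ha; obtain ⟨y, rfl⟩ := hb; obtain ⟨z, rfl⟩ := hc
    ring_nf at hs4; omega
  · exfalso; obtain ⟨x, rfl⟩ := ha; obtain ⟨y, rfl⟩ := hb; obtain ⟨z, rfl⟩ := hc
    ring_nf at hs4; omega
  · exact reorder 1 ha hb hc
  · exfalso; obtain ⟨x, rfl⟩ := ha; obtain ⟨y, rfl⟩ := hb; obtain ⟨z, rfl⟩ := hc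
    ring_nf at hs4; omega
  · exact reorder (Equiv.swap 0 1) (by simpa using hb) (by simpa using ha)
      (by simpa [Equiv.swap_apply_of_ne_of_ne] using hc)
  · exact reorder (Equiv.swap 0 2) (by simpa using hc)
      (by simpa [Equiv.swap_apply_of_ne_of_ne] using hb) (by simpa using ha)
  · exfalso; obtain ⟨x, rfl⟩ := ha; obtain ⟨y, rfl⟩ := hb; obtain ⟨z, rfl⟩ := hc
    ring_nf at hs4; omega

/-- If all integer points on the sphere of squared radius `t ≡ 2 (mod 4)` are signed permutations
of `w`, then `w` is primitive. -/
lemma gcd_eq_one_of_perm_abs_eq {t : ℕ} (hmod : t % 4 = 2) {w : Fin 3 → ℤ}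
    (hw : ∑ j, w j ^ 2 = t) (h : ∀ u : Fin 3 → ℤ, ∑ j, u j ^ 2 = t →
      ∃ σ : Equiv.Perm (Fin 3), ∀ j, |u j| = |w (σ j)|) :
    Finset.univ.gcd w = 1 := by
  obtain ⟨g, hg, hg1⟩ := Finset.extract_gcd w Finset.univ_nonempty
  set d := Finset.univ.gcd w
  have hwg : ∀ j, w j = d * g j := fun j => hg j (Finset.mem_univ j)
  have htd : (t : ℤ) = d ^ 2 * (g 0 ^ 2 + g 1 ^ 2 + g 2 ^ 2) := by
    rw [← hw, Fin.sum_univ_three, hwg, hwg, hwg]; ring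
  have hd0 : d ≠ 0 := by
    intro h0; rw [h0] at htd; simp at htd; omega
  by_contra hne
  have hnat : d.natAbs ≠ 1 := by
    intro h1
    have hn : normalize d = d := Finset.normalize_gcd
    rw [← Int.abs_eq_normalize, ← Int.natCast_natAbs, h1] at hn
    exact hne hn.symm
  obtain ⟨p, hp, e, he⟩ := Nat.exists_prime_and_dvd hnat
  obtain ⟨e, he⟩ : (p : ℤ) ∣ d := Int.natCast_dvd.mpr ⟨e, he⟩
  have he0 : e ≠ 0 := by rintro rfl; simp at he; exact hd0 he
  have hp2 : p ≠ 2 := by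
    rintro rfl
    have : (4 : ℤ) ∣ t := ⟨e ^ 2 * (g 0 ^ 2 + g 1 ^ 2 + g 2 ^ 2), by rw [htd, he]; push_cast; ring⟩
    omega
  obtain ⟨q, x, y, z, hq, hx, hy⟩ := hp.sum_four_squares_ne_zero
  have hdvd := dvd_of_rotation_dvd hp hp2 (a := g 0) (b := g 1) (c := g 2) hq hx hy (by
    intro u₀ u₁ u₂ hu
    obtain ⟨σ, hσ⟩ := h (fun j => e * ![u₀, u₁, u₂] j) (by
      rw [htd, he, Fin.sum_univ_three]
      simp only [Matrix.cons_val]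
      linear_combination e ^ 2 * hu)
    have hall : ∀ j, (p : ℤ) ∣ ![u₀, u₁, u₂] j := by
      intro j
      have hj := hσ j
      rw [hwg, he, mul_comm (p : ℤ) e, mul_assoc, abs_mul, abs_mul e] at hj
      have hj' := mul_left_cancel₀ (abs_ne_zero.mpr he0) hj
      rw [← dvd_abs, hj', dvd_abs]
      exact dvd_mul_right _ _
    exact ⟨hall 0, hall 1, hall 2⟩)
  have hp1 : (p : ℤ) ∣ Finset.univ.gcd g := Finset.dvd_gcd (by
    intro j _
    fin_cases j
    exacts [hdvd.1, hdvd.2.1, hdvd.2.2])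
  rw [hg1] at hp1
  exact (Nat.prime_iff_prime_int.mp hp).not_dvd_one hp1

/-- A primitive integer vector orthogonal to two non-parallel vectors with entries bounded by `5`
has squared norm at most `7500`. -/
lemma minors_eq_zero_of_orthogonal {w r s : Fin 3 → ℤ} (hw : Finset.univ.gcd w = 1)
    (hbig : 7500 < w 0 ^ 2 + w 1 ^ 2 + w 2 ^ 2)
    (hr : ∀ k, |r k| ≤ 5) (hs : ∀ k, |s k| ≤ 5)
    (hrw : r 0 * w 0 + r 1 * w 1 + r 2 * w 2 = 0) (hsw : s 0 * w 0 + s 1 * w 1 + s 2 * w 2 = 0) :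
    r 0 * s 1 = r 1 * s 0 ∧ r 0 * s 2 = r 2 * s 0 := by
  obtain ⟨m₀, hm₀⟩ : ∃ m, m = r 1 * s 2 - r 2 * s 1 := ⟨_, rfl⟩
  obtain ⟨m₁, hm₁⟩ : ∃ m, m = r 2 * s 0 - r 0 * s 2 := ⟨_, rfl⟩
  obtain ⟨m₂, hm₂⟩ : ∃ m, m = r 0 * s 1 - r 1 * s 0 := ⟨_, rfl⟩
  have e₀ : m₁ * w 2 = m₂ * w 1 := by
    rw [hm₁, hm₂]; linear_combination s 0 * hrw - r 0 * hsw
  have e₁ : m₂ * w 0 = m₀ * w 2 := by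
    rw [hm₂, hm₀]; linear_combination s 1 * hrw - r 1 * hsw
  have e₂ : m₀ * w 1 = m₁ * w 0 := by
    rw [hm₀, hm₁]; linear_combination s 2 * hrw - r 2 * hsw
  obtain ⟨g, hg⟩ : ∃ g : Fin 3 → ℤ, ∑ k, g k * w k = 1 := by
    obtain ⟨g, hg⟩ := Finset.gcd_eq_sum_mul Finset.univ w
    exact ⟨g, by simpa [hw, mul_comm] using hg.symm⟩
  rw [Fin.sum_univ_three] at hg
  obtain ⟨l, hl⟩ : ∃ m, m = g 0 * m₀ + g 1 * m₁ + g 2 * m₂ := ⟨_, rfl⟩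
  have f₀ : m₀ = l * w 0 := by
    rw [hl]; linear_combination (-m₀) * hg + g 1 * e₂ - g 2 * e₁
  have f₁ : m₁ = l * w 1 := by
    rw [hl]; linear_combination (-m₁) * hg + g 2 * e₀ - g 0 * e₂
  have f₂ : m₂ = l * w 2 := by
    rw [hl]; linear_combination (-m₂) * hg + g 0 * e₁ - g 1 * e₀
  have hl0 : l = 0 := by
    by_contra hne
    have bound : ∀ i j, |r i * s j - r j * s i| ≤ 50 := by
      intro i j
      have b : ∀ i j, |r i * s j| ≤ 25 := fun i j => by
        rw [abs_mul]; nlinarith [hr i, hs j, abs_nonneg (r i), abs_nonneg (s j)]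
      exact (abs_sub _ _).trans (by linarith [b i j, b j i])
    have b₀ := sq_le_sq' (abs_le.mp (bound 1 2)).1 (abs_le.mp (bound 1 2)).2
    have b₁ := sq_le_sq' (abs_le.mp (bound 2 0)).1 (abs_le.mp (bound 2 0)).2
    have b₂ := sq_le_sq' (abs_le.mp (bound 0 1)).1 (abs_le.mp (bound 0 1)).2
    rw [← hm₀, f₀] at b₀
    rw [← hm₁, f₁] at b₁
    rw [← hm₂, f₂] at b₂
    have hl1 : 1 ≤ l ^ 2 := by have := sq_pos_of_ne_zero hne; omega
    nlinarith
  rw [hl0, zero_mul] at f₁ f₂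
  constructor <;> linarith

/-- Signed counts `s` and counts `n` of the three values `a, b, c` in the three coordinates of a
five-cycle: if the rows of `s` are pairwise parallel and `a` occurs oddly often in each coordinate,
three times in the last one, then that last row has all entries `±1`. -/
lemma abs_eq_one_of_parallel_rows {n s : Fin 3 → Fin 3 → ℤ} {i j l : Fin 3}
    (hsn : ∀ j k, |s j k| ≤ n j k) (hpar : ∀ j k, s j k % 2 = n j k % 2)
    (hrow : ∀ j, n j 0 + n j 1 + n j 2 = 5) (hcol : ∀ k, n i k + n j k + n l k = 5)
    (hi : n i 0 = 1) (hj : n j 0 = 1) (hl : n l 0 = 3)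
    (hmin : ∀ j j', s j 0 * s j' 1 = s j 1 * s j' 0 ∧ s j 0 * s j' 2 = s j 2 * s j' 0) :
    |s l 0| = 1 ∧ |s l 1| = 1 ∧ |s l 2| = 1 := by
  have unit : ∀ {m : Fin 3}, n m 0 = 1 → s m 0 = 1 ∨ s m 0 = -1 := by
    intro m hm
    have h1 := abs_le.mp (hsn m 0)
    have h2 := hpar m 0
    omega
  have hn : ∀ k, 0 ≤ n l k := fun k => (abs_nonneg _).trans (hsn l k)
  have par : ∀ {k}, s i 0 * s l k = s i k * s l 0 → s j 0 * s l k = s j k * s l 0 →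
      n l k % 2 = 1 ∧ s l 0 ∣ s l k := by
    intro k h1 h2
    have h3 := hpar l 0
    have hc := hcol k
    have p1 := hpar i k
    have p2 := hpar j k
    have p3 := hpar l k
    have h4 : s l 0 % 2 = 1 := by omega
    have q1 : s i k * s l 0 % 2 = s i k % 2 := by rw [Int.mul_emod, h4]; omega
    have q2 : s j k * s l 0 % 2 = s j k % 2 := by rw [Int.mul_emod, h4]; omega
    rcases unit hi with hi | hi <;> rcases unit hj with hj | hj <;> rw [hi] at h1 <;>
      rw [hj] at h2 <;> refine ⟨by omega, ?_⟩
    · exact ⟨s i k, by linarith⟩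
    · exact ⟨s i k, by linarith⟩
    · exact ⟨-s i k, by linarith⟩
    · exact ⟨-s i k, by linarith⟩
  obtain ⟨o1, d1⟩ := par (hmin i l).1 (hmin j l).1
  obtain ⟨o2, -⟩ := par (hmin i l).2 (hmin j l).2
  have a1 := abs_le.mp (hsn l 1)
  have a2 := abs_le.mp (hsn l 2)
  have p1 := hpar l 1
  have p2 := hpar l 2
  have hr := hrow l
  have n1 := hn 1
  have n2 := hn 2
  have t1 : |s l 1| = 1 := (abs_eq one_pos.le).mpr (by omega)
  have t2 : |s l 2| = 1 := (abs_eq one_pos.le).mpr (by omega)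
  refine ⟨?_, t1, t2⟩
  rw [← abs_dvd_abs, t1] at d1
  exact Int.eq_one_of_dvd_one (abs_nonneg _) d1

/-- If a prime `p ≡ 2 (mod 3)` divides `x² + xy + y²`, then it divides `x`. -/
lemma dvd_of_dvd_sq_add_mul_add_sq {p : ℕ} (hp : p.Prime) (hp3 : p % 3 = 2) {x y : ℤ}
    (h : (p : ℤ) ∣ x ^ 2 + x * y + y ^ 2) : (p : ℤ) ∣ x := by
  have := Fact.mk hp
  rw [← ZMod.intCast_zmod_eq_zero_iff_dvd] at h ⊢
  push_cast at h
  by_contra hx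
  set X : ZMod p := (x : ZMod p)
  set Y : ZMod p := (y : ZMod p)
  have hcube : X ^ 3 = Y ^ 3 := by linear_combination (X - Y) * h
  have hY : Y ≠ 0 := by
    intro h0
    rw [h0] at hcube
    exact hx (by simpa using hcube)
  obtain ⟨k, hk⟩ : ∃ k, p - 1 = 3 * k + 1 := ⟨p / 3, by omega⟩
  have hX1 := ZMod.pow_card_sub_one_eq_one hx
  have hY1 := ZMod.pow_card_sub_one_eq_one hY
  rw [hk, pow_succ, pow_mul] at hX1 hY1
  rw [← hY1, hcube] at hX1
  have hXY : X = Y := mul_left_cancel₀ (pow_ne_zero _ (pow_ne_zero _ hY)) hX1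
  rw [hXY] at h
  have h3 : (3 : ZMod p) * Y ^ 2 = 0 := by linear_combination h
  rcases mul_eq_zero.mp h3 with h3 | h3
  · have : p ∣ 3 := (ZMod.natCast_eq_zero_iff 3 p).mp (by exact_mod_cast h3)
    rw [Nat.prime_dvd_prime_iff_eq hp Nat.prime_three] at this
    omega
  · exact hY (by simpa using h3)

/-- A five-cycle of signed permutations of a primitive vector `w` with one even coordinate forces
`w 0 = ±w 1 ± w 2`, unless `w` is short. -/
lemma exists_sign_relation {w : Fin 3 → ℤ} (hw : Finset.univ.gcd w = 1)
    (hbig : 7500 < w 0 ^ 2 + w 1 ^ 2 + w 2 ^ 2) (h0 : Even (w 0)) (h1 : Odd (w 1)) (h2 : Odd (w 2))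
    {v : Fin 5 → Fin 3 → ℤ} {σ : Fin 5 → Equiv.Perm (Fin 3)}
    (hv : ∀ i j, |v i j| = |w (σ i j)|) (hsum : ∑ i, v i = 0) :
    ∃ x y z : ℤ, |x| = 1 ∧ |y| = 1 ∧ |z| = 1 ∧ x * w 0 + y * w 1 + z * w 2 = 0 := by
  have hε : ∀ i j, ∃ ε : ℤ, |ε| = 1 ∧ v i j = ε * w (σ i j) := by
    intro i j
    rcases abs_eq_abs.mp (hv i j) with h | h
    · exact ⟨1, by simp, by simpa using h⟩
    · exact ⟨-1, by simp, by simpa using h⟩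
  choose ε hε1 hεv using hε
  set n : Fin 3 → Fin 3 → ℤ := fun j k => ∑ i, if σ i j = k then 1 else 0
  set s : Fin 3 → Fin 3 → ℤ := fun j k => ∑ i, if σ i j = k then ε i j else 0 with hs
  have hsn : ∀ j k, |s j k| ≤ n j k := by
    intro j k
    refine (Finset.abs_sum_le_sum_abs _ _).trans (Finset.sum_le_sum fun i _ => ?_)
    split_ifs <;> simp [hε1]
  have hpar : ∀ j k, s j k % 2 = n j k % 2 := by
    intro j k
    refine Int.ModEq.sum fun i _ => ?_
    have hsign := eq_or_eq_neg_of_abs_eq (hε1 i j)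
    split_ifs
    · change ε i j % 2 = 1 % 2
      omega
    · rfl
  have hrow : ∀ j, n j 0 + n j 1 + n j 2 = 5 := by
    intro j
    rw [← Fin.sum_univ_three (n j), Finset.sum_comm]
    simp
  have hcol : ∀ k, n 0 k + n 1 k + n 2 k = 5 := by
    intro k
    rw [← Fin.sum_univ_three (fun j => n j k), Finset.sum_comm]
    simp [← Equiv.eq_symm_apply]
  have horth : ∀ j, s j 0 * w 0 + s j 1 * w 1 + s j 2 * w 2 = 0 := by
    intro j
    rw [← Fin.sum_univ_three (fun k => s j k * w k)]
    simp only [hs, Finset.sum_mul]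
    rw [Finset.sum_comm]
    have hj := congrFun hsum j
    simp only [Finset.sum_apply, Pi.zero_apply, hεv] at hj
    simpa [ite_mul] using hj
  have hodd : ∀ j, n j 0 % 2 = 1 := by
    intro j
    have e := horth j
    obtain ⟨x, hx⟩ := h0
    obtain ⟨y, hy⟩ := h1
    obtain ⟨z, hz⟩ := h2
    have e' : s j 1 + s j 2 = 2 * -(s j 0 * x + s j 1 * y + s j 2 * z) := by
      rw [hx, hy, hz] at e
      linear_combination e
    have p0 := hpar j 0
    have p1 := hpar j 1
    have p2 := hpar j 2
    have hr := hrow j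
    omega
  have hn0 : ∀ j k, 0 ≤ n j k := fun j k => (abs_nonneg _).trans (hsn j k)
  have hs5 : ∀ j k, |s j k| ≤ 5 := by
    intro j k
    refine (hsn j k).trans ?_
    rw [← hrow j, ← Fin.sum_univ_three (n j)]
    exact Finset.single_le_sum (fun k _ => hn0 j k) (Finset.mem_univ k)
  have hmin := fun j j' =>
    minors_eq_zero_of_orthogonal hw hbig (hs5 j) (hs5 j') (horth j) (horth j')
  have finish : ∀ i j l, (∀ k, n i k + n j k + n l k = 5) → n i 0 = 1 → n j 0 = 1 → n l 0 = 3 →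
      ∃ x y z : ℤ, |x| = 1 ∧ |y| = 1 ∧ |z| = 1 ∧ x * w 0 + y * w 1 + z * w 2 = 0 := by
    intro i j l hc hi hj hl
    obtain ⟨u0, u1, u2⟩ := abs_eq_one_of_parallel_rows hsn hpar hrow hc hi hj hl hmin
    exact ⟨_, _, _, u0, u1, u2, horth l⟩
  have c0 := hcol 0
  have o0 := hodd 0
  have o1 := hodd 1
  have o2 := hodd 2
  have a0 := hn0 0 0
  have a1 := hn0 1 0
  have a2 := hn0 2 0
  have hcases : (n 0 0 = 1 ∧ n 1 0 = 1 ∧ n 2 0 = 3) ∨ (n 0 0 = 1 ∧ n 1 0 = 3 ∧ n 2 0 = 1) ∨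
      (n 0 0 = 3 ∧ n 1 0 = 1 ∧ n 2 0 = 1) := by omega
  rcases hcases with ⟨x, y, z⟩ | ⟨x, y, z⟩ | ⟨x, y, z⟩
  · exact finish 0 1 2 hcol x y z
  · exact finish 0 2 1 (fun k => by linarith [hcol k]) x z y
  · exact finish 1 2 0 (fun k => by linarith [hcol k]) y z x

/-- Let `t ≥ 10^6` with `t ≡ 2 (mod 4)`, whose square-free part contains an
odd prime factor congruent to 2 mod 3, and suppose `P(t) = 1` (exactly one representation
`t = a² + b² + c²` with `0 ≤ a ≤ b ≤ c`). Then `C₃(t) > 5`: there do not exist five vectors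
in `ℤ³`, each of squared norm `t`, summing to the zero vector. -/
theorem no_five_cycle_of_unique_rep (t : ℕ) (hge : 10 ^ 6 ≤ t) (hmod : t % 4 = 2)
    (hT : ∃ p : ℕ, p.Prime ∧ p ≠ 2 ∧ p % 3 = 2 ∧ Odd (t.factorization p))
    (hP : ∃! x : ℤ × ℤ × ℤ, IsThreeSquareRep t x) :
    ¬ ∃ v : Fin 5 → (Fin 3 → ℤ),
      (∀ i, ∑ j, (v i j) ^ 2 = (t : ℤ)) ∧ (∑ i, v i) = 0 := by
  rintro ⟨v, hv, hsum⟩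
  obtain ⟨p, hp, hp2, hp3, hpodd⟩ := hT
  obtain ⟨w, hwt, h0, h1, h2, hperm⟩ := exists_perm_abs_eq hmod hP
  have hprim := gcd_eq_one_of_perm_abs_eq hmod hwt hperm
  choose σ hσ using fun i => hperm (v i) (hv i)
  rw [Fin.sum_univ_three] at hwt
  have hge' : (10 ^ 6 : ℤ) ≤ t := by exact_mod_cast hge
  obtain ⟨x, y, z, hx, hy, hz, hrel⟩ :=
    exists_sign_relation hprim (by rw [hwt]; linarith) h0 h1 h2 hσ hsum
  have hx2 : x ^ 2 = 1 := by rw [← sq_abs, hx, one_pow]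
  have hy2 : y ^ 2 = 1 := by rw [← sq_abs, hy, one_pow]
  have hz2 : z ^ 2 = 1 := by rw [← sq_abs, hz, one_pow]
  have hpt : (p : ℤ) ∣ t := by
    have : p ∣ t := Nat.dvd_of_factorization_pos hpodd.pos.ne'
    exact_mod_cast this
  have hpp : Prime (p : ℤ) := Nat.prime_iff_prime_int.mp hp
  have ht : (t : ℤ) = 2 * ((y * w 1) ^ 2 + (y * w 1) * (z * w 2) + (z * w 2) ^ 2) := by
    rw [← hwt]
    linear_combination (-w 0 ^ 2) * hx2 - w 1 ^ 2 * hy2 - w 2 ^ 2 * hz2 +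
      (x * w 0 - y * w 1 - z * w 2) * hrel
  have hform : (p : ℤ) ∣ (y * w 1) ^ 2 + (y * w 1) * (z * w 2) + (z * w 2) ^ 2 := by
    rw [ht] at hpt
    refine (hpp.dvd_or_dvd hpt).resolve_left fun h => hp2 ?_
    exact (Nat.prime_dvd_prime_iff_eq hp Nat.prime_two).mp (by exact_mod_cast h)
  have hd1 := dvd_of_dvd_sq_add_mul_add_sq hp hp3 hform
  have hd2 : (p : ℤ) ∣ z * w 2 :=
    dvd_of_dvd_sq_add_mul_add_sq hp hp3 (y := y * w 1) (by convert hform using 1; ring)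
  have hd0 : (p : ℤ) ∣ x * w 0 := by
    have : x * w 0 = -(y * w 1 + z * w 2) := by linarith
    rw [this, dvd_neg]
    exact dvd_add hd1 hd2
  have strip : ∀ {e r : ℤ}, |e| = 1 → (p : ℤ) ∣ e * r → (p : ℤ) ∣ r := by
    intro e r he h
    rwa [← dvd_abs, abs_mul, he, one_mul, dvd_abs] at h
  have hp1 : (p : ℤ) ∣ Finset.univ.gcd w := Finset.dvd_gcd (by
    intro j _
    fin_cases j
    exacts [strip hx hd0, strip hy hd1, strip hz hd2])
  rw [hprim] at hp1
  exact hpp.not_dvd_one hp1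
end

section
/- Let t be a positive integer with t >= 10^6, t congruent to 2 modulo 4, whose square-free part contains at least one odd prime factor congruent to 2 modulo 3. If there exist five vectors in Z^3, each with squared Euclidean norm t, summing to the zero vector (i.e., C_3(t) = 5), then P(t) >= 2, i.e., t has at least two representations t = a^2 + b^2 + c^2 with integers 0 <= a <= b <= c. -/
/-- Sorting the absolute values of the coordinates of a vector of squared norm `t` gives an
ordered representation. -/
lemma exists_perm_isThreeSquareRep {t : ℕ} (v : Fin 3 → ℤ) (hv : ∑ j, v j ^ 2 = (t : ℤ)) :
    ∃ τ : Equiv.Perm (Fin 3), IsThreeSquareRep t (|v (τ 0)|, |v (τ 1)|, |v (τ 2)|) := by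
  have hmono := Tuple.monotone_sort (fun j => |v j|)
  refine ⟨Tuple.sort (fun j => |v j|), abs_nonneg _, hmono (by decide : (0 : Fin 3) ≤ 1),
    hmono (by decide : (1 : Fin 3) ≤ 2), ?_⟩
  rw [← hv, ← Equiv.sum_comp (Tuple.sort (fun j => |v j|)) (fun j => v j ^ 2),
    Fin.sum_univ_three]
  simp only [sq_abs]

/-- If `t` has at most one ordered representation, any two vectors of squared norm `t` are signed
permutations of each other. -/
lemma exists_perm_abs_eq_s11 {t : ℕ}
    (h : ¬ ∃ x y : ℤ × ℤ × ℤ, x ≠ y ∧ IsThreeSquareRep t x ∧ IsThreeSquareRep t y)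
    (v w : Fin 3 → ℤ) (hv : ∑ j, v j ^ 2 = (t : ℤ)) (hw : ∑ j, w j ^ 2 = (t : ℤ)) :
    ∃ σ : Equiv.Perm (Fin 3), ∀ j, |v j| = |w (σ j)| := by
  obtain ⟨τ, hτ⟩ := exists_perm_isThreeSquareRep v hv
  obtain ⟨ρ, hρ⟩ := exists_perm_isThreeSquareRep w hw
  have heq : (|v (τ 0)|, |v (τ 1)|, |v (τ 2)|) = (|w (ρ 0)|, |w (ρ 1)|, |w (ρ 2)|) := by
    by_contra hne
    exact h ⟨_, _, hne, hτ, hρ⟩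
  simp only [Prod.mk.injEq] at heq
  have hall : ∀ i, |v (τ i)| = |w (ρ i)| := by
    intro i
    fin_cases i
    exacts [heq.1, heq.2.1, heq.2.2]
  refine ⟨τ.symm.trans ρ, fun j => ?_⟩
  simpa using hall (τ.symm j)

/-- An integer linear form divisible by an odd prime `p` on all vectors of the same norm as `y`
has all coefficients divisible by `p`, unless `p` divides `y`. -/
lemma dvd_coeff_of_dvd_on_sphere {p : ℤ} (hp : Prime p) (hp2 : ¬ p ∣ 2) (l y : Fin 3 → ℤ)
    (k : Fin 3) (hk : ¬ p ∣ y k)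
    (h : ∀ w : Fin 3 → ℤ, ∑ j, w j ^ 2 = ∑ j, y j ^ 2 → p ∣ ∑ j, l j * w j) (j : Fin 3) :
    p ∣ l j := by
  have hw : ∑ i, y (Equiv.swap j k i) ^ 2 = ∑ i, y i ^ 2 :=
    Equiv.sum_comp (Equiv.swap j k) (fun i => y i ^ 2)
  have hw' : ∑ i, (if i = j then -y (Equiv.swap j k i) else y (Equiv.swap j k i)) ^ 2
      = ∑ i, y i ^ 2 := by
    rw [← hw]
    refine Finset.sum_congr rfl fun i _ => ?_
    split_ifs <;> ring
  have hsub := dvd_sub (h (fun i => y (Equiv.swap j k i)) hw) (h _ hw')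
  rw [← Finset.sum_sub_distrib] at hsub
  have hval : ∑ i, (l i * y (Equiv.swap j k i)
      - l i * (if i = j then -y (Equiv.swap j k i) else y (Equiv.swap j k i)))
      = l j * (2 * y k) := by
    rw [Finset.sum_eq_single j]
    · simp only [if_true, Equiv.swap_apply_left]
      ring
    · intro i _ hij
      simp [hij]
    · simp
  rw [hval] at hsub
  rcases hp.dvd_or_dvd hsub with h1 | h1
  · exact h1
  · exact absurd h1 (fun h2 => (hp.dvd_or_dvd h2).elim hp2 hk)

/-- The integral matrix of the Euler–Rodrigues rotation attached to a quaternion. -/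
def rodrigues (a b c d : ℤ) : Fin 3 → Fin 3 → ℤ :=
  ![![a ^ 2 + b ^ 2 - c ^ 2 - d ^ 2, 2 * (b * c - a * d), 2 * (b * d + a * c)],
    ![2 * (b * c + a * d), a ^ 2 - b ^ 2 + c ^ 2 - d ^ 2, 2 * (c * d - a * b)],
    ![2 * (b * d - a * c), 2 * (c * d + a * b), a ^ 2 - b ^ 2 - c ^ 2 + d ^ 2]]

lemma sum_sq_rodrigues (a b c d : ℤ) (y : Fin 3 → ℤ) :
    ∑ i, (∑ j, rodrigues a b c d i j * y j) ^ 2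
      = (a ^ 2 + b ^ 2 + c ^ 2 + d ^ 2) ^ 2 * ∑ j, y j ^ 2 := by
  simp [Fin.sum_univ_three, rodrigues]
  ring

/-- For an odd prime `p`, the rotation matrix of a quaternion of norm `p` does not vanish
modulo `p`. -/
lemma exists_not_dvd_rodrigues {p : ℤ} (hp : Prime p) (hp2 : ¬ p ∣ 2) (a b c d : ℤ)
    (h : a ^ 2 + b ^ 2 + c ^ 2 + d ^ 2 = p) : ∃ i j, ¬ p ∣ rodrigues a b c d i j := by
  by_contra! hall
  have h0 : p ∣ a ^ 2 + b ^ 2 - c ^ 2 - d ^ 2 := hall 0 0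
  have h1 : p ∣ a ^ 2 - b ^ 2 + c ^ 2 - d ^ 2 := hall 1 1
  have h2 : p ∣ a ^ 2 - b ^ 2 - c ^ 2 + d ^ 2 := hall 2 2
  have hself : p ∣ a ^ 2 + b ^ 2 + c ^ 2 + d ^ 2 := h ▸ dvd_rfl
  have key : ∀ z : ℤ, p ∣ 2 * (2 * z ^ 2) → p ^ 2 ∣ z ^ 2 := fun z hz =>
    pow_dvd_pow_of_dvd (hp.dvd_of_dvd_pow
      (((hp.dvd_or_dvd (((hp.dvd_or_dvd hz).resolve_left hp2))).resolve_left hp2))) 2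
  have ha : p ^ 2 ∣ a ^ 2 := key a (by
    have hdvd := ((h0.add h1).add h2).add hself
    ring_nf at hdvd ⊢
    exact hdvd)
  have hb : p ^ 2 ∣ b ^ 2 := key b (by
    have hdvd := ((h0.sub h1).sub h2).add hself
    ring_nf at hdvd ⊢
    exact hdvd)
  have hc : p ^ 2 ∣ c ^ 2 := key c (by
    have hdvd := ((h1.sub h0).sub h2).add hself
    ring_nf at hdvd ⊢
    exact hdvd)
  have hd : p ^ 2 ∣ d ^ 2 := key d (by
    have hdvd := ((h2.sub h0).sub h1).add hself
    ring_nf at hdvd ⊢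
    exact hdvd)
  have hpp : p ^ 2 ∣ p := by
    have := ((ha.add hb).add hc).add hd
    rwa [h] at this
  obtain ⟨m, hm⟩ := hpp
  have : p * m = 1 := by
    have : p * (p * m) = p * 1 := by linarith [hm, (by ring : p ^ 2 * m = p * (p * m))]
    exact mul_left_cancel₀ hp.ne_zero this
  exact hp.not_isUnit (IsUnit.of_mul_eq_one _ this)

/-- Every nonzero integer vector is a multiple of a primitive one. -/
lemma exists_primitive_vector (x : Fin 3 → ℤ) (hx : x ≠ 0) :
    ∃ (g : ℤ) (y u : Fin 3 → ℤ), (∀ j, x j = g * y j) ∧ ∑ j, u j * y j = 1 := by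
  obtain ⟨g, hg⟩ := (IsPrincipalIdealRing.principal (Ideal.span (Set.range x))).principal
  have hmem : ∀ j, ∃ c, c * g = x j := fun j =>
    Submodule.mem_span_singleton.1 (hg ▸ Ideal.subset_span (Set.mem_range_self j))
  choose y hy using hmem
  have hgm : g ∈ Ideal.span (Set.range x) := by
    rw [hg]; exact Submodule.mem_span_singleton_self g
  obtain ⟨u, hu⟩ := (Ideal.mem_span_range_iff_exists_fun).1 hgm
  have hg0 : g ≠ 0 := by
    rintro rfl
    exact hx (funext fun j => by simpa using (hy j).symm)
  refine ⟨g, y, u, fun j => by rw [← hy j, mul_comm], ?_⟩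
  apply mul_left_cancel₀ hg0
  rw [mul_one, Finset.mul_sum]
  conv_rhs => rw [← hu]
  exact Finset.sum_congr rfl fun j _ => by rw [← hy j]; ring

/-- If `t ≡ 2 (mod 4)` has at most one ordered representation, every vector of squared norm `t`
is primitive. -/
lemma exists_bezout_of_unique {t : ℕ} (hmod : t % 4 = 2)
    (h : ¬ ∃ x y : ℤ × ℤ × ℤ, x ≠ y ∧ IsThreeSquareRep t x ∧ IsThreeSquareRep t y)
    (x : Fin 3 → ℤ) (hx : ∑ j, x j ^ 2 = (t : ℤ)) : ∃ u : Fin 3 → ℤ, ∑ j, u j * x j = 1 := by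
  have hx0 : x ≠ 0 := by
    rintro rfl
    simp at hx
    omega
  obtain ⟨g, y, u, hxy, hu⟩ := exists_primitive_vector x hx0
  have hnorm : g ^ 2 * ∑ j, y j ^ 2 = t := by
    rw [← hx, Finset.mul_sum]
    exact Finset.sum_congr rfl fun j _ => by rw [hxy j]; ring
  by_cases hg : IsUnit g
  · obtain ⟨g', hg'⟩ := hg.exists_left_inv
    refine ⟨fun j => g' * u j, ?_⟩
    rw [← hu]
    refine Finset.sum_congr rfl fun j _ => ?_
    rw [hxy j]
    linear_combination (u j * y j) * hg'
  exfalso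
  obtain ⟨p, hp, hpg⟩ := Int.exists_prime_and_dvd (n := g) (by
    rwa [Int.isUnit_iff_natAbs_eq] at hg)
  obtain ⟨q, hq, hqp⟩ : ∃ q : ℕ, q.Prime ∧ (q : ℤ) ∣ g :=
    ⟨p.natAbs, Int.prime_iff_natAbs_prime.1 hp, Int.natAbs_dvd.2 hpg⟩
  have hqP : Prime (q : ℤ) := Nat.prime_iff_prime_int.1 hq
  obtain ⟨m, hm⟩ := hqp
  have hq2 : ¬ (q : ℤ) ∣ 2 := by
    intro hd
    have hqe : q = 2 := (Nat.prime_dvd_prime_iff_eq hq Nat.prime_two).1 (by exact_mod_cast hd)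
    have h4 : (4 : ℤ) ∣ t := ⟨m ^ 2 * ∑ j, y j ^ 2, by rw [← hnorm, hm, hqe]; push_cast; ring⟩
    omega
  have hg0 : g ≠ 0 := by
    rintro rfl
    simp at hnorm
    omega
  have hm0 : m ≠ 0 := by
    rintro rfl
    simp [hm] at hg0
  obtain ⟨a, b, c, d, habcd⟩ := Nat.sum_four_squares q
  have hZ : (a : ℤ) ^ 2 + (b : ℤ) ^ 2 + (c : ℤ) ^ 2 + (d : ℤ) ^ 2 = q := by exact_mod_cast habcd
  obtain ⟨i, j, hij⟩ := exists_not_dvd_rodrigues hqP hq2 a b c d hZ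
  obtain ⟨k, hk⟩ : ∃ k, ¬ (q : ℤ) ∣ y k := by
    by_contra! hall
    have : (q : ℤ) ∣ 1 := hu ▸ Finset.dvd_sum fun j _ => (hall j).mul_left _
    exact hqP.not_isUnit (isUnit_of_dvd_one this)
  refine hij (dvd_coeff_of_dvd_on_sphere hqP hq2 _ y k hk (fun w hw => ?_) j)
  obtain ⟨σ, hσ⟩ := exists_perm_abs_eq_s11 h (fun i => m * ∑ j, rodrigues a b c d i j * w j) x (by
    simp only [mul_pow]
    rw [← Finset.mul_sum, sum_sq_rodrigues, hZ, hw, ← hnorm, hm]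
    ring) hx
  have h1 : g ∣ m * ∑ j, rodrigues a b c d i j * w j := by
    rw [← dvd_abs, hσ i, dvd_abs, hxy]
    exact dvd_mul_right _ _
  rw [hm, mul_comm (q : ℤ)] at h1
  exact (mul_dvd_mul_iff_left hm0).1 h1

/-- A prime `p ≡ 2 (mod 3)` dividing `a² + ab + b²` divides both `a` and `b`. -/
lemma dvd_of_dvd_sq_add_mul_add_sq_s11 {p : ℕ} (hp : p.Prime) (h3 : p % 3 = 2) (a b : ℤ)
    (h : (p : ℤ) ∣ a ^ 2 + a * b + b ^ 2) : (p : ℤ) ∣ a ∧ (p : ℤ) ∣ b := by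
  have := Fact.mk hp
  simp only [← ZMod.intCast_zmod_eq_zero_iff_dvd] at h ⊢
  push_cast at h
  generalize (a : ZMod p) = A at *
  generalize (b : ZMod p) = B at *
  have hcube : A ^ 3 = B ^ 3 := by linear_combination (A - B) * h
  obtain ⟨k, hk⟩ : ∃ k, p = 3 * k + 2 := ⟨p / 3, by omega⟩
  have hA : (A ^ 3) ^ k * A ^ 2 = A := by rw [← pow_mul, ← pow_add, ← hk, ZMod.pow_card]
  have hB : (A ^ 3) ^ k * B ^ 2 = B := by
    rw [hcube, ← pow_mul, ← pow_add, ← hk, ZMod.pow_card]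
  have hprod : A * B * (A - B) = 0 := by linear_combination B ^ 2 * hA - A ^ 2 * hB
  have hthree : (3 : ZMod p) ≠ 0 := by
    intro h0
    have : p ∣ 3 := (ZMod.natCast_eq_zero_iff 3 p).1 (by exact_mod_cast h0)
    rw [(Nat.prime_dvd_prime_iff_eq hp Nat.prime_three).1 this] at h3
    omega
  rcases mul_eq_zero.1 hprod with h1 | h1
  · rcases mul_eq_zero.1 h1 with h2 | h2 <;> subst h2 <;> simpa using h
  · have hAB : A = B := sub_eq_zero.1 h1
    subst hAB
    have : (3 : ZMod p) * A ^ 2 = 0 := by linear_combination h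
    have hA0 := pow_eq_zero_iff (two_ne_zero) |>.1 ((mul_eq_zero.1 this).resolve_left hthree)
    exact ⟨hA0, hA0⟩

/-- A sum of three squares `t ≡ 2 (mod 4)` has exactly one even term. -/
lemma even_of_sum_sq_mod_four {a b c : ℤ} {t : ℕ} (hmod : t % 4 = 2)
    (h : a ^ 2 + b ^ 2 + c ^ 2 = t) :
    (Even a ∧ ¬ Even b ∧ ¬ Even c) ∨ (¬ Even a ∧ Even b ∧ ¬ Even c) ∨
      (¬ Even a ∧ ¬ Even b ∧ Even c) := by
  have key : ∀ z : ℤ, (Even z ∧ z ^ 2 % 4 = 0) ∨ (¬ Even z ∧ z ^ 2 % 4 = 1) := by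
    intro z
    rcases Int.even_or_odd z with hz | hz
    · obtain ⟨k, rfl⟩ := hz
      exact Or.inl ⟨⟨k, rfl⟩, by ring_nf; omega⟩
    · refine Or.inr ⟨Int.not_even_iff_odd.2 hz, ?_⟩
      obtain ⟨k, rfl⟩ := hz
      ring_nf
      omega
  rcases key a with ⟨ha, ha'⟩ | ⟨ha, ha'⟩ <;> rcases key b with ⟨hb, hb'⟩ | ⟨hb, hb'⟩ <;>
    rcases key c with ⟨hc, hc'⟩ | ⟨hc, hc'⟩ <;> first | (exfalso; omega) | tauto

/-- Two integer relations on a primitive vector `x` whose coefficients have absolute values summing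
to at most `5` are proportional once `x` has squared norm greater than `625`. -/
lemma relations_proportional {r s x u : Fin 3 → ℤ} (hu : ∑ j, u j * x j = 1)
    (hx : 625 < ∑ j, x j ^ 2) (hr : ∑ k, r k * x k = 0) (hs : ∑ k, s k * x k = 0)
    (hr5 : ∑ k, |r k| ≤ 5) (hs5 : ∑ k, |s k| ≤ 5) (k l : Fin 3) : r k * s l = r l * s k := by
  simp only [Fin.sum_univ_three] at *
  have bound : ∀ f : Fin 3 → ℤ, |f 0| + |f 1| + |f 2| ≤ 5 →
      f 0 ^ 2 + f 1 ^ 2 + f 2 ^ 2 ≤ 25 := by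
    intro f hf
    have h0 := abs_nonneg (f 0)
    have h1 := abs_nonneg (f 1)
    have h2 := abs_nonneg (f 2)
    rw [← sq_abs (f 0), ← sq_abs (f 1), ← sq_abs (f 2)]
    nlinarith [mul_nonneg h0 h1, mul_nonneg h0 h2, mul_nonneg h1 h2]
  have hr25 := bound r hr5
  have hs25 := bound s hs5
  obtain ⟨n0, hn0⟩ : ∃ n, n = r 1 * s 2 - r 2 * s 1 := ⟨_, rfl⟩
  obtain ⟨n1, hn1⟩ : ∃ n, n = r 2 * s 0 - r 0 * s 2 := ⟨_, rfl⟩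
  obtain ⟨n2, hn2⟩ : ∃ n, n = r 0 * s 1 - r 1 * s 0 := ⟨_, rfl⟩
  obtain ⟨m, hm⟩ : ∃ m, m = u 0 * n0 + u 1 * n1 + u 2 * n2 := ⟨_, rfl⟩
  have e01 : n0 * x 1 = n1 * x 0 := by
    rw [hn0, hn1]; linear_combination s 2 * hr - r 2 * hs
  have e02 : n0 * x 2 = n2 * x 0 := by
    rw [hn0, hn2]; linear_combination r 1 * hs - s 1 * hr
  have e12 : n1 * x 2 = n2 * x 1 := by
    rw [hn1, hn2]; linear_combination s 0 * hr - r 0 * hs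
  have h0 : n0 = m * x 0 := by rw [hm]; linear_combination -n0 * hu + u 1 * e01 + u 2 * e02
  have h1 : n1 = m * x 1 := by rw [hm]; linear_combination -n1 * hu - u 0 * e01 + u 2 * e12
  have h2 : n2 = m * x 2 := by rw [hm]; linear_combination -n2 * hu - u 0 * e02 - u 1 * e12
  have hle : n0 ^ 2 + n1 ^ 2 + n2 ^ 2 ≤ 625 := by
    have hlag : n0 ^ 2 + n1 ^ 2 + n2 ^ 2 + (r 0 * s 0 + r 1 * s 1 + r 2 * s 2) ^ 2
        = (r 0 ^ 2 + r 1 ^ 2 + r 2 ^ 2) * (s 0 ^ 2 + s 1 ^ 2 + s 2 ^ 2) := by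
      rw [hn0, hn1, hn2]; ring
    have := mul_le_mul hr25 hs25 (by positivity) (by norm_num)
    nlinarith [sq_nonneg (r 0 * s 0 + r 1 * s 1 + r 2 * s 2)]
  have hm0 : m = 0 := by
    by_contra hne
    have hm1 : 1 ≤ m ^ 2 := by have := sq_pos_of_ne_zero hne; omega
    rw [h0, h1, h2] at hle
    nlinarith
  rw [hm0, zero_mul] at h0 h1 h2
  fin_cases k <;> fin_cases l <;> simp <;> linarith

/-- A matrix of odd integers with proportional rows, whose rows and columns have absolute values
summing to at most `5`, has all entries `±1` in its first row. -/
lemma abs_eq_one_of_proportional {R : Fin 3 → Fin 3 → ℤ}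
    (hprop : ∀ i j k l, R i k * R j l = R i l * R j k) (hodd : ∀ j k, ¬ Even (R j k))
    (hrow : ∀ j, ∑ k, |R j k| ≤ 5) (hcol : ∀ k, ∑ j, |R j k| ≤ 5) (k : Fin 3) :
    |R 0 k| = 1 := by
  have hpos : ∀ j k, 1 ≤ |R j k| := by
    intro j k
    have : R j k ≠ 0 := fun h0 => hodd j k (h0 ▸ Even.zero)
    have := abs_pos.2 this
    omega
  by_contra hne
  have hge : 3 ≤ |R 0 k| := by
    have h1 := hpos 0 k
    have h2 : ¬ Even |R 0 k| := by rw [even_abs]; exact hodd 0 k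
    rw [Int.even_iff] at h2
    omega
  have habs : ∀ j l, |R 0 k| * |R j l| = |R 0 l| * |R j k| := fun j l => by
    rw [← abs_mul, ← abs_mul, hprop]
  obtain ⟨l, hl⟩ : ∃ l, |R 0 l| = 1 := by
    have h0 := hpos 0 0
    have h1 := hpos 0 1
    have h2 := hpos 0 2
    have h5 := hrow 0
    rw [Fin.sum_univ_three] at h5
    fin_cases k
    · exact ⟨1, by simp at hge; omega⟩
    · exact ⟨0, by simp at hge; omega⟩
    · exact ⟨0, by simp at hge; omega⟩
  have hbig : ∀ j, 3 ≤ |R j k| := by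
    intro j
    have := habs j l
    rw [hl, one_mul] at this
    nlinarith [hpos j l]
  have h5 := hcol k
  rw [Fin.sum_univ_three] at h5
  linarith [hbig 0, hbig 1, hbig 2]

/-- A relation with coefficients `±1` on `x` makes every prime `p ≡ 2 (mod 3)`, `p ≠ 2`, that
divides the squared norm of `x` divide `x` itself. -/
lemma dvd_of_sign_relation {p : ℕ} (hp : p.Prime) (hp2 : p ≠ 2) (h3 : p % 3 = 2)
    {r x : Fin 3 → ℤ} (hr : ∀ k, |r k| = 1) (hrel : ∑ k, r k * x k = 0)
    (hdvd : (p : ℤ) ∣ ∑ k, x k ^ 2) (k : Fin 3) : (p : ℤ) ∣ x k := by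
  have hpP : Prime (p : ℤ) := Nat.prime_iff_prime_int.1 hp
  have hsq : ∀ k, r k ^ 2 = 1 := fun k => by rw [← sq_abs, hr k, one_pow]
  rw [Fin.sum_univ_three] at hrel hdvd
  have htwo : (p : ℤ) ∣ 2 * ((r 0 * x 0) ^ 2 + (r 0 * x 0) * (r 1 * x 1) + (r 1 * x 1) ^ 2) := by
    convert hdvd using 1
    linear_combination x 0 ^ 2 * hsq 0 + x 1 ^ 2 * hsq 1 + x 2 ^ 2 * hsq 2
      + (r 0 * x 0 + r 1 * x 1 - r 2 * x 2) * hrel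
  have hnot2 : ¬ (p : ℤ) ∣ 2 := fun h =>
    hp2 ((Nat.prime_dvd_prime_iff_eq hp Nat.prime_two).1 (by exact_mod_cast h))
  obtain ⟨h0, h1⟩ := dvd_of_dvd_sq_add_mul_add_sq_s11 hp h3 _ _
    ((hpP.dvd_or_dvd htwo).resolve_left hnot2)
  have h2 : (p : ℤ) ∣ r 2 * x 2 := by
    have : r 2 * x 2 = -(r 0 * x 0 + r 1 * x 1) := by linarith
    rw [this]
    exact (h0.add h1).neg_right
  have hall : (p : ℤ) ∣ r k * x k := by
    fin_cases k
    exacts [h0, h1, h2]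
  have hx : x k = r k * (r k * x k) := by linear_combination -x k * hsq k
  rw [hx]
  exact hall.mul_left _

/-- Signed permutations of `x` summing to zero give a matrix of integer relations on `x`, congruent
modulo `2` to a nonnegative matrix dominating it whose rows and columns all sum to `n`. -/
lemma exists_relation_matrix {n : ℕ} (v : Fin n → Fin 3 → ℤ) (x : Fin 3 → ℤ)
    (hsum : ∑ i, v i = 0) (σ : Fin n → Equiv.Perm (Fin 3))
    (hσ : ∀ i j, |v i j| = |x (σ i j)|) :
    ∃ R N : Fin 3 → Fin 3 → ℤ, (∀ j, ∑ k, R j k * x k = 0) ∧ (∀ j k, |R j k| ≤ N j k) ∧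
      (∀ j k, Even (R j k - N j k)) ∧ (∀ j, ∑ k, N j k = n) ∧ (∀ k, ∑ j, N j k = n) := by
  have hsign : ∀ i j, ∃ s : ℤ, (s = 1 ∨ s = -1) ∧ v i j = s * x (σ i j) := by
    intro i j
    rcases abs_eq_abs.1 (hσ i j) with h | h
    · exact ⟨1, Or.inl rfl, by rw [h, one_mul]⟩
    · exact ⟨-1, Or.inr rfl, by rw [h, neg_one_mul]⟩
  choose s hs hv using hsign
  refine ⟨fun j k => ∑ i, if σ i j = k then s i j else 0,
    fun j k => ∑ i, if σ i j = k then 1 else 0, ?_, ?_, ?_, ?_, ?_⟩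
  · intro j
    simp only [Finset.sum_mul]
    rw [Finset.sum_comm]
    have := congrFun hsum j
    rw [Finset.sum_apply] at this
    refine Eq.trans (Finset.sum_congr rfl fun i _ => ?_) this
    simp [hv]
  · intro j k
    refine (Finset.abs_sum_le_sum_abs _ _).trans (Finset.sum_le_sum fun i _ => ?_)
    rcases hs i j with h | h <;> split_ifs <;> simp [h]
  · intro j k
    rw [← Finset.sum_sub_distrib]
    refine Finset.even_sum _ fun i _ => ?_
    rcases hs i j with h | h <;> split_ifs <;> simp [h]
  · intro j
    rw [Finset.sum_comm]
    simp
  · intro k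
    rw [Finset.sum_comm]
    simp [← Equiv.eq_symm_apply]

/-- Let `t ≥ 10^6` with `t ≡ 2 (mod 4)`, whose square-free part contains an
odd prime factor congruent to 2 mod 3. If there exist five vectors in `ℤ³`, each of squared
norm `t`, summing to the zero vector, then `P(t) ≥ 2`: `t` has at least two representations
`t = a² + b² + c²` with `0 ≤ a ≤ b ≤ c`. -/
theorem two_reps_of_five_cycle (t : ℕ) (hge : 10 ^ 6 ≤ t) (hmod : t % 4 = 2)
    (hT : ∃ p : ℕ, p.Prime ∧ p ≠ 2 ∧ p % 3 = 2 ∧ Odd (t.factorization p))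
    (hcyc : ∃ v : Fin 5 → (Fin 3 → ℤ),
      (∀ i, ∑ j, (v i j) ^ 2 = (t : ℤ)) ∧ (∑ i, v i) = 0) :
    ∃ x y : ℤ × ℤ × ℤ, x ≠ y ∧ IsThreeSquareRep t x ∧ IsThreeSquareRep t y := by
  by_contra huniq
  obtain ⟨p, hp, hp2, hp3, hpodd⟩ := hT
  obtain ⟨v, hv, hsum⟩ := hcyc
  obtain ⟨x, hx⟩ : ∃ x : Fin 3 → ℤ, ∑ j, x j ^ 2 = (t : ℤ) := ⟨v 0, hv 0⟩
  obtain ⟨u, hu⟩ := exists_bezout_of_unique hmod huniq x hx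
  choose σ hσ using fun i => exists_perm_abs_eq_s11 huniq (v i) x (hv i) hx
  obtain ⟨R, N, hrel, hle, hpar, hNrow, hNcol⟩ := exists_relation_matrix v x hsum σ hσ
  have hrow : ∀ j, ∑ k, |R j k| ≤ 5 := fun j =>
    (Finset.sum_le_sum fun k _ => hle j k).trans_eq (hNrow j)
  have hcol : ∀ k, ∑ j, |R j k| ≤ 5 := fun k =>
    (Finset.sum_le_sum fun j _ => hle j k).trans_eq (hNcol k)
  have hprop : ∀ i j k l, R i k * R j l = R i l * R j k := fun i j k l =>
    relations_proportional hu (by rw [hx]; omega) (hrel i) (hrel j) (hrow i) (hrow j) k l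
  have hodd : ∀ j k, ¬ Even (R j k) := by
    have hparity : ∀ j k, Even (R j k) ↔ Even (N j k) := fun j k => Int.even_sub.1 (hpar j k)
    have five : ¬ Even ((5 : ℕ) : ℤ) := by decide
    have hRrow : ∀ j, ¬ (Even (R j 0) ↔ (Even (R j 1) ↔ Even (R j 2))) := fun j => by
      have h5 := five
      rw [← hNrow j, Fin.sum_univ_three, Int.even_add, Int.even_add] at h5
      simp only [hparity]
      tauto
    have hRcol : ∀ k, ¬ (Even (R 0 k) ↔ (Even (R 1 k) ↔ Even (R 2 k))) := fun k => by
      have h5 := five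
      rw [← hNcol k, Fin.sum_univ_three, Int.even_add, Int.even_add] at h5
      simp only [hparity]
      tauto
    have hReven : ∀ j, Even (R j 0 * x 0 + R j 1 * x 1 + R j 2 * x 2) := fun j => by
      rw [← Fin.sum_univ_three (fun k => R j k * x k), hrel j]
      exact Even.zero
    simp only [Int.even_add, Int.even_mul] at hReven
    obtain ⟨k₀, hk₀⟩ : ∃ k₀, ∀ j, ¬ Even (R j k₀) := by
      rw [Fin.sum_univ_three] at hx
      rcases even_of_sum_sq_mod_four hmod hx with h | h | h
      · refine ⟨0, fun j => ?_⟩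
        have := hRrow j
        have := hReven j
        tauto
      · refine ⟨1, fun j => ?_⟩
        have := hRrow j
        have := hReven j
        tauto
      · refine ⟨2, fun j => ?_⟩
        have := hRrow j
        have := hReven j
        tauto
    have hsame : ∀ i j k, Even (R i k) ↔ Even (R j k) := fun i j k => by
      have h1 := congrArg Even (hprop i j k k₀)
      simpa only [Int.even_mul, hk₀, or_false, false_or, eq_iff_iff] using h1
    intro j k
    have h1 := hsame j 0 k
    have h2 := hsame 0 1 k
    have h3 := hsame 0 2 k
    have h4 := hRcol k
    tauto
  have hpt : (p : ℤ) ∣ ∑ k, x k ^ 2 := by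
    rw [hx]
    have : t.factorization p ≠ 0 := fun h0 => by simp [h0] at hpodd
    exact_mod_cast Nat.dvd_of_factorization_pos this
  have hpx := dvd_of_sign_relation hp hp2 hp3
    (abs_eq_one_of_proportional hprop hodd hrow hcol) (hrel 0) hpt
  have hp1 : (p : ℤ) ∣ 1 := hu ▸ Finset.dvd_sum fun k _ => (hpx k).mul_left _
  exact (Nat.prime_iff_prime_int.1 hp).not_isUnit (isUnit_of_dvd_one hp1)
end

section
/- Let n be a natural number and, for each i in {1, ..., n}, let f_{i,1}, ..., f_{i,5} be Z-linear maps from Z^2 to Z^3 such that for all (x, y) in Z^2 the five vectors f_{i,1}(x,y), ..., f_{i,5}(x,y) sum to the zero vector and all have equal squared Euclidean norm (so that each parameterization P_i yields vector cycles of length 5 whose squared magnitude is a binary quadratic form in x and y). Then there exists a positive integer t, congruent to 2 modulo 4, whose square-free part contains at least one odd prime factor congruent to 2 modulo 3, such that for no i in {1, ..., n} and no (x, y) in Z^2 does the common squared Euclidean norm of f_{i,1}(x,y), ..., f_{i,5}(x,y) equal t. -/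
/-- If `p ≡ -1 (mod 4E)` then `-E` is a quadratic nonresidue modulo the prime `p`, so `p` divides
`z² + E y²` only if it divides `y`. -/
theorem prime_dvd_of_dvd_sq_add_mul_sq {p E : ℕ} (hp : p.Prime) (hE : 0 < E)
    (h : 4 * E ∣ p + 1) {z y : ℤ} (hd : (p : ℤ) ∣ z ^ 2 + E * y ^ 2) : (p : ℤ) ∣ y := by
  have : Fact p.Prime := ⟨hp⟩
  obtain ⟨m, hm⟩ := h
  have hEm : 0 < E * m := by
    rcases Nat.eq_zero_or_pos (E * m) with h0 | h0
    · rw [mul_assoc, h0] at hm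
      omega
    · exact h0
  have hm' : p + 1 = 4 * (E * m) := by rw [hm, mul_assoc]
  have hp4 : p % 4 = 3 := by omega
  have hodd : Odd p := Nat.odd_iff.2 (by omega)
  have hmod : p % (4 * E) = 4 * E - 1 := by
    obtain ⟨k, rfl⟩ : ∃ k, m = k + 1 := Nat.exists_eq_succ_of_ne_zero (by rintro rfl; simp at hEm)
    have : p = (4 * E - 1) + 4 * E * k := by
      rw [mul_add, mul_one] at hm
      omega
    rw [this, Nat.add_mul_mod_self_left]
    exact Nat.mod_eq_of_lt (by omega)
  have hodd' : Odd (4 * E - 1) := Nat.odd_iff.2 (by omega)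
  have hJ : jacobiSym (E : ℤ) p = 1 := by
    rw [jacobiSym.mod_right _ hodd, Int.natAbs_natCast, hmod]
    have h1 : jacobiSym ((2 : ℤ) ^ 2 * E) (4 * E - 1) = 1 := by
      have : ((2 : ℤ) ^ 2 * E) = 1 + ((4 * E - 1 : ℕ) : ℤ) := by
        push_cast [Nat.cast_sub (show 1 ≤ 4 * E by omega)]
        ring
      rw [this, jacobiSym.mod_left, Int.add_emod_right, ← jacobiSym.mod_left, jacobiSym.one_left]
    rwa [jacobiSym.mul_left, jacobiSym.sq_one', one_mul] at h1
    rw [Int.gcd_eq_natAbs]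
    simpa using hodd'.coprime_two_left
  have hneg : legendreSym p (-(E : ℤ)) = -1 := by
    rw [← neg_one_mul, legendreSym.mul, legendreSym.at_neg_one (by omega),
      ZMod.χ₄_nat_three_mod_four hp4, jacobiSym.legendreSym.to_jacobiSym, hJ]
    norm_num
  exact (legendreSym.prime_dvd_of_eq_neg_one hneg (x := z) (y := y) (by simpa using hd)).2

/-- The positive semidefinite form `a x² + 2 b x y + c y²` does not represent `2p` when `p` is a
large prime with `p ≡ -1` modulo four times its determinant. -/
theorem form_ne_two_mul_prime {p : ℕ} (hp : p.Prime) (hp2 : 2 < p) {a b c : ℤ} {E : ℕ}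
    (hE : a * c - b ^ 2 = E) (ha : a.natAbs < p) (hc : c.natAbs < p)
    (h : 0 < E → 4 * E ∣ p + 1) (x y : ℤ) :
    a * x ^ 2 + 2 * b * x * y + c * y ^ 2 ≠ 2 * p := by
  intro heq
  have hpZ : Prime (p : ℤ) := Nat.prime_iff_prime_int.1 hp
  have hsmall : ∀ k : ℤ, k.natAbs < p → (p : ℤ) ∣ k → k = 0 := fun k hk hd =>
    Int.eq_zero_of_dvd_of_natAbs_lt_natAbs hd (by simpa using hk)
  have hp0 : (p : ℤ) ≠ 0 := hpZ.ne_zero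
  have hsq : ∀ k : ℤ, k.natAbs < p → k ≠ 0 → ¬ (p : ℤ) ^ 2 ∣ k * (2 * p) := by
    intro k hk hk0 hd
    rw [pow_two, ← mul_assoc] at hd
    rcases hpZ.dvd_or_dvd (Int.dvd_of_mul_dvd_mul_right hp0 hd) with h1 | h1
    · exact hk0 (hsmall _ hk h1)
    · exact absurd (hsmall 2 (by simpa using hp2) h1) (by norm_num)
  by_cases ha0 : a = 0
  · subst ha0
    have hb : b = 0 := by
      have : b ^ 2 ≤ 0 := by linarith [Int.natCast_nonneg E]
      exact pow_eq_zero_iff two_ne_zero |>.1 (le_antisymm this (sq_nonneg b))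
    subst hb
    have hcy : c * y ^ 2 = 2 * p := by linarith
    have hc0 : c ≠ 0 := by
      rintro rfl
      simp [hp.ne_zero] at hcy
    have hy : (p : ℤ) ∣ y := by
      rcases hpZ.dvd_or_dvd (Dvd.intro_left _ hcy.symm) with h1 | h1
      · exact absurd (hsmall _ hc h1) hc0
      · exact hpZ.dvd_of_dvd_pow h1
    refine hsq 1 (by simpa using hp.one_lt) one_ne_zero ?_
    rw [one_mul, ← hcy]
    exact Dvd.dvd.mul_left (pow_dvd_pow_of_dvd hy 2) c
  · have hkey : (a * x + b * y) ^ 2 + E * y ^ 2 = a * (2 * p) := by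
      rw [← hE, ← heq]
      ring
    have hdvd : (p : ℤ) ∣ (a * x + b * y) ^ 2 + E * y ^ 2 := by
      rw [hkey]
      exact ⟨a * 2, by ring⟩
    refine hsq a ha ha0 ?_
    rw [← hkey]
    rcases Nat.eq_zero_or_pos E with rfl | hE0
    · simp only [Nat.cast_zero, zero_mul, add_zero] at hdvd ⊢
      exact pow_dvd_pow_of_dvd (hpZ.dvd_of_dvd_pow hdvd) 2
    · have hy := prime_dvd_of_dvd_sq_add_mul_sq hp hE0 (h hE0) hdvd
      have hy2 := Dvd.dvd.mul_left (dvd_pow hy two_ne_zero) (E : ℤ)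
      exact dvd_add (pow_dvd_pow_of_dvd
        (hpZ.dvd_of_dvd_pow ((dvd_add_left hy2).1 hdvd)) 2)
        (Dvd.dvd.mul_left (pow_dvd_pow_of_dvd hy 2) _)

/-- Finitely many positive semidefinite forms `a x² + 2 b x y + c y²` fail to represent `2p` for
some prime `p ≡ 2 (mod 3)`. -/
theorem exists_prime_forms_ne_two_mul {ι : Type*} [Fintype ι] (a b c : ι → ℤ)
    (hdet : ∀ i, (b i) ^ 2 ≤ a i * c i) :
    ∃ p : ℕ, p.Prime ∧ 2 < p ∧ p % 3 = 2 ∧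
      ∀ i x y, a i * x ^ 2 + 2 * b i * x * y + c i * y ^ 2 ≠ 2 * p := by
  classical
  choose E hE using fun i => Int.eq_ofNat_of_zero_le (sub_nonneg.2 (hdet i))
  set M : ℕ := 12 * ∏ i, (if E i = 0 then 1 else E i) with hM
  have hM0 : M ≠ 0 := by
    refine mul_ne_zero (by norm_num) (Finset.prod_ne_zero_iff.2 fun i _ => ?_)
    split_ifs with h0
    · exact one_ne_zero
    · exact h0
  have : NeZero M := ⟨hM0⟩
  obtain ⟨p, hgt, hp, hmod⟩ := Nat.forall_exists_prime_gt_and_eq_mod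
    (q := M) (a := -1) isUnit_one.neg (2 + ∑ i, ((a i).natAbs + (c i).natAbs))
  have hdvd : M ∣ p + 1 := by
    rw [← ZMod.natCast_eq_zero_iff]
    push_cast
    rw [hmod]
    ring
  refine ⟨p, hp, by omega, ?_, fun i x y => ?_⟩
  · have : 3 ∣ p + 1 := (Dvd.intro _ (by rw [hM]; ring : 3 * (4 * ∏ i, _) = M)).trans hdvd
    omega
  · have hi := Finset.single_le_sum (f := fun i => (a i).natAbs + (c i).natAbs)
      (fun _ _ => Nat.zero_le _) (Finset.mem_univ i)
    refine form_ne_two_mul_prime hp (by omega) (hE i) (by omega) (by omega) (fun h0 => ?_) x y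
    refine Dvd.dvd.trans (mul_dvd_mul (by norm_num) ?_) hdvd
    have := Finset.dvd_prod_of_mem (fun i => if E i = 0 then 1 else E i) (Finset.mem_univ i)
    simpa [h0.ne'] using this

/-- Given finitely many parameterizations of length-5 vector cycles in `ℤ³`
(each a family of five `ℤ`-linear maps `ℤ² → ℤ³` which for every input produce five vectors
of equal squared norm summing to zero), there exists a positive integer `t ≡ 2 (mod 4)`,
whose square-free part contains an odd prime factor congruent to 2 mod 3, which is not
represented by any of the parameterizations. -/
theorem exists_t_not_represented (n : ℕ)
    (f : Fin n → Fin 5 → ((Fin 2 → ℤ) →ₗ[ℤ] (Fin 3 → ℤ)))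
    (hsum : ∀ (i : Fin n) (xy : Fin 2 → ℤ), (∑ k, f i k xy) = 0)
    (hnorm : ∀ (i : Fin n) (xy : Fin 2 → ℤ) (k k' : Fin 5),
      ∑ j, (f i k xy j) ^ 2 = ∑ j, (f i k' xy j) ^ 2) :
    ∃ t : ℕ, 0 < t ∧ t % 4 = 2 ∧
      (∃ p : ℕ, p.Prime ∧ p ≠ 2 ∧ p % 3 = 2 ∧ Odd (t.factorization p)) ∧
      ∀ (i : Fin n) (xy : Fin 2 → ℤ) (k : Fin 5),
        ∑ j, (f i k xy j) ^ 2 ≠ (t : ℤ) := by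
  obtain ⟨p, hp, hp2, hp3, hne⟩ := exists_prime_forms_ne_two_mul (ι := Fin n × Fin 5)
    (fun q => ∑ j, (f q.1 q.2 (Pi.single 0 1) j) ^ 2)
    (fun q => ∑ j, f q.1 q.2 (Pi.single 0 1) j * f q.1 q.2 (Pi.single 1 1) j)
    (fun q => ∑ j, (f q.1 q.2 (Pi.single 1 1) j) ^ 2)
    (fun q => Finset.sum_mul_sq_le_sq_mul_sq _ _ _)
  have hpodd := hp.eq_two_or_odd
  refine ⟨2 * p, by omega, by omega, ⟨p, hp, by omega, hp3, ?_⟩, fun i xy k heq => ?_⟩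
  · rw [Nat.factorization_mul two_ne_zero hp.ne_zero, Finsupp.add_apply, hp.factorization_self,
      Nat.factorization_eq_zero_of_not_dvd fun h => absurd (Nat.le_of_dvd two_pos h) (by omega)]
    exact odd_one
  · refine hne (i, k) (xy 0) (xy 1) ?_
    have hxy : xy = xy 0 • Pi.single 0 1 + xy 1 • Pi.single 1 1 := by
      ext j
      fin_cases j <;> simp
    rw [hxy, map_add, map_smul, map_smul] at heq
    push_cast at heq
    rw [← heq]
    simp only [Fin.sum_univ_three, Pi.add_apply, Pi.smul_apply, smul_eq_mul]
    ring
end
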